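/- arXiv:1604.05783 — 3 statements merged into one kernel-verified Lean document; each statement's English description precedes it below -/
import Mathlib

section
/- (Time response estimate I: row sums of the plasma echo kernel.) Let β > 10. There is a constant C(β) such that for all T > 0 and all k ∈ ℝ³: ∫₀^T ∫_{ℝ³} ⟨τ⟩ |k|^{1/2} |ℓ|^{1/2} ⟨ℓ⟩^{−2} ⟨k−ℓ, kT−ℓτ⟩^{−β} dℓ dτ ≤ C(β). -/
open MeasureTheory Real Complex
open scoped ENNReal

noncomputable section

abbrev E3 : Type := EuclideanSpace ℝ (Fin 3)

/-- the Japanese bracket ⟨x⟩ = (1+|x|²)^{1/2} -/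
def jb (x : E3) : ℝ := Real.sqrt (1 + ‖x‖^2)
/-- ⟨a,b⟩ = (1+|a|²+|b|²)^{1/2} -/
def jbp (a b : E3) : ℝ := Real.sqrt (1 + ‖a‖^2 + ‖b‖^2)
/-- ⟨t⟩ for scalars -/
def jbR (t : ℝ) : ℝ := Real.sqrt (1 + t^2)

lemma jbp_pos (a b : E3) : 0 < jbp a b := Real.sqrt_pos.2 (by positivity)

lemma jb_le_jbp_left (a b : E3) : jb a ≤ jbp a b :=
  Real.sqrt_le_sqrt (by linarith [sq_nonneg ‖b‖])

lemma jb_le_jbp_right (a b : E3) : jb b ≤ jbp a b :=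
  Real.sqrt_le_sqrt (by linarith [sq_nonneg ‖a‖])

lemma one_le_jb (x : E3) : 1 ≤ jb x :=
  Real.one_le_sqrt.2 (by linarith [sq_nonneg ‖x‖])

lemma norm_le_jb (x : E3) : ‖x‖ ≤ jb x :=
  Real.le_sqrt_of_sq_le (by linarith)

lemma echo_weight_le (k ℓ b : E3) :
    ‖k‖ ^ (1/2 : ℝ) * ‖ℓ‖ ^ (1/2 : ℝ) * (jb ℓ) ^ (-2 : ℝ) ≤ 2 * jbp (k - ℓ) b := by
  have hL := one_le_jb ℓ
  have hl := norm_le_jb ℓ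
  have hP : 1 ≤ jbp (k - ℓ) b := (one_le_jb _).trans (jb_le_jbp_left _ _)
  have hd : ‖k - ℓ‖ ≤ jbp (k - ℓ) b := (norm_le_jb _).trans (jb_le_jbp_left _ _)
  have hk : ‖k‖ ≤ ‖k - ℓ‖ + ‖ℓ‖ := by simpa using norm_add_le (k - ℓ) ℓ
  generalize jbp (k - ℓ) b = P at *
  generalize jb ℓ = L at *
  have hLp : 0 < L := by linarith
  rw [Real.rpow_neg hLp.le, Real.rpow_two, ← div_eq_mul_inv, div_le_iff₀ (by positivity),
    ← Real.mul_rpow (norm_nonneg _) (norm_nonneg _), ← Real.sqrt_eq_rpow]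
  have hk' : ‖k‖ ≤ 2 * P * L := by nlinarith
  have h1 : ‖k‖ * ‖ℓ‖ ≤ 2 * P * L * L := by gcongr
  have h2 : 1 ≤ 2 * P * L ^ 2 := by nlinarith [one_le_pow₀ hL (n := 2)]
  exact Real.sqrt_le_iff.2 ⟨by positivity, by nlinarith⟩

lemma echo_kernel_le {β : ℝ} (hβ : 1 ≤ β) (τ : ℝ) (k ℓ b x : E3)
    (hx : jb x ≤ jbp (k - ℓ) b) :
    jbR τ * ‖k‖ ^ (1/2 : ℝ) * ‖ℓ‖ ^ (1/2 : ℝ) * (jb ℓ) ^ (-2 : ℝ) * (jbp (k - ℓ) b) ^ (-β)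
      ≤ 2 * jbR τ * jb x ^ (-(β - 1)) := by
  have hP := jbp_pos (k - ℓ) b
  have hR : 0 ≤ jbR τ := Real.sqrt_nonneg _
  calc _ = jbR τ * (‖k‖ ^ (1/2 : ℝ) * ‖ℓ‖ ^ (1/2 : ℝ) * (jb ℓ) ^ (-2 : ℝ))
        * (jbp (k - ℓ) b) ^ (-β) := by ring
    _ ≤ jbR τ * (2 * jbp (k - ℓ) b) * (jbp (k - ℓ) b) ^ (-β) := by
        gcongr ?_ * _
        exact mul_le_mul_of_nonneg_left (echo_weight_le k ℓ b) hR
    _ = 2 * jbR τ * (jbp (k - ℓ) b) ^ (-(β - 1)) := by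
        rw [show -(β - 1) = 1 + -β by ring, Real.rpow_add hP, Real.rpow_one]
        ring
    _ ≤ 2 * jbR τ * jb x ^ (-(β - 1)) := by
        gcongr 2 * jbR τ * ?_
        exact Real.rpow_le_rpow_of_nonpos (by linarith [one_le_jb x]) hx (by linarith)

lemma lintegral_jb_rpow_lt_top {r : ℝ} (hr : 3 < r) :
    ∫⁻ x : E3, ENNReal.ofReal (jb x ^ (-r)) < ∞ := by
  have h : Integrable (fun x : E3 => ((1 : ℝ) + ‖x‖ ^ 2) ^ (-r / 2)) :=
    integrable_rpow_neg_one_add_norm_sq (by simpa using hr)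
  convert h.lintegral_lt_top using 4 with x
  rw [jb, Real.sqrt_eq_rpow, ← Real.rpow_mul (by positivity)]
  ring_nf

lemma lintegral_comp_sub_smul (f : E3 → ℝ≥0∞) (hf : Measurable f) (c : E3) {t : ℝ} (ht : 0 < t) :
    ∫⁻ x : E3, f (c - t • x) = ENNReal.ofReal ((t ^ 3)⁻¹) * ∫⁻ x, f x := by
  have h1 : ∫⁻ x : E3, f (c - t • x)
      = ∫⁻ y, f (c - y) ∂(Measure.map (t • ·) (volume : Measure E3)) :=
    (lintegral_map (f := fun y => f (c - y)) (by fun_prop) (by fun_prop)).symm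
  rw [h1, Measure.map_addHaar_smul _ ht.ne', lintegral_smul_measure, lintegral_sub_left_eq_self]
  simp [abs_of_pos ht]

lemma measurable_jb_rpow (r : ℝ) : Measurable fun x : E3 => ENNReal.ofReal (jb x ^ r) := by
  unfold jb
  fun_prop

lemma jbR_le_of_le_one {τ : ℝ} (h0 : 0 ≤ τ) (h1 : τ ≤ 1) :
    2 * jbR τ ≤ 8 * (1 + τ ^ 2)⁻¹ := by
  have h : jbR τ ≤ 2 := Real.sqrt_le_iff.2 ⟨by norm_num, by nlinarith⟩
  rw [← div_eq_mul_inv, le_div_iff₀ (by positivity)]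
  nlinarith [Real.sqrt_nonneg (1 + τ ^ 2)]

lemma jbR_mul_le_of_one_le {τ : ℝ} (h1 : 1 ≤ τ) :
    2 * jbR τ * (τ ^ 3)⁻¹ ≤ 8 * (1 + τ ^ 2)⁻¹ := by
  have h : jbR τ ≤ 2 * τ := Real.sqrt_le_iff.2 ⟨by linarith, by nlinarith⟩
  rw [← div_eq_mul_inv, ← div_eq_mul_inv, div_le_div_iff₀ (by positivity) (by positivity)]
  calc 2 * jbR τ * (1 + τ ^ 2) ≤ 2 * (2 * τ) * (τ ^ 2 + τ ^ 2) := by gcongr; nlinarith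
    _ = 8 * τ ^ 3 := by ring

lemma echo_inner_le {β : ℝ} (hβ : 1 ≤ β) (T : ℝ) (k : E3) {τ : ℝ} (h0 : 0 ≤ τ) :
    ∫⁻ ℓ : E3, ENNReal.ofReal (jbR τ * ‖k‖ ^ (1/2 : ℝ) * ‖ℓ‖ ^ (1/2 : ℝ) *
          (jb ℓ) ^ (-2 : ℝ) * (jbp (k - ℓ) (T • k - τ • ℓ)) ^ (-β))
      ≤ ENNReal.ofReal (8 * (1 + τ ^ 2)⁻¹) *
        ∫⁻ x : E3, ENNReal.ofReal (jb x ^ (-(β - 1))) := by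
  have hR : 0 ≤ 2 * jbR τ := mul_nonneg two_pos.le (Real.sqrt_nonneg _)
  rcases le_total τ 1 with h1 | h1
  · calc _ ≤ ∫⁻ ℓ : E3, ENNReal.ofReal (2 * jbR τ) *
            ENNReal.ofReal (jb (k - ℓ) ^ (-(β - 1))) := by
          refine lintegral_mono fun ℓ => ?_
          rw [← ENNReal.ofReal_mul hR]
          exact ENNReal.ofReal_le_ofReal (echo_kernel_le hβ _ _ _ _ _ (jb_le_jbp_left _ _))
      _ = ENNReal.ofReal (2 * jbR τ) * ∫⁻ x : E3, ENNReal.ofReal (jb x ^ (-(β - 1))) := by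
          rw [lintegral_const_mul' _ _ ENNReal.ofReal_ne_top,
            lintegral_sub_left_eq_self (fun x : E3 => ENNReal.ofReal (jb x ^ (-(β - 1))))]
      _ ≤ _ := by
          gcongr ENNReal.ofReal ?_ * _
          exact jbR_le_of_le_one h0 h1
  · calc _ ≤ ∫⁻ ℓ : E3, ENNReal.ofReal (2 * jbR τ) *
            ENNReal.ofReal (jb (T • k - τ • ℓ) ^ (-(β - 1))) := by
          refine lintegral_mono fun ℓ => ?_
          rw [← ENNReal.ofReal_mul hR]
          exact ENNReal.ofReal_le_ofReal (echo_kernel_le hβ _ _ _ _ _ (jb_le_jbp_right _ _))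
      _ = ENNReal.ofReal (2 * jbR τ * (τ ^ 3)⁻¹) *
            ∫⁻ x : E3, ENNReal.ofReal (jb x ^ (-(β - 1))) := by
          rw [lintegral_const_mul' _ _ ENNReal.ofReal_ne_top,
            lintegral_comp_sub_smul (fun x : E3 => ENNReal.ofReal (jb x ^ (-(β - 1))))
              (measurable_jb_rpow _) _ (by linarith), ENNReal.ofReal_mul hR, mul_assoc]
      _ ≤ _ := by
          gcongr ENNReal.ofReal ?_ * _
          exact jbR_mul_le_of_one_le h1

/-- Time response estimate I: row sums of the plasma echo kernel. -/
theorem time_response_I (β : ℝ) (hβ : 10 < β) :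
    ∃ C : ℝ, 0 < C ∧ ∀ T : ℝ, 0 < T → ∀ k : E3,
      (∫⁻ τ in Set.Icc (0:ℝ) T, ∫⁻ ℓ : E3,
        ENNReal.ofReal (jbR τ * ‖k‖ ^ (1/2 : ℝ) * ‖ℓ‖ ^ (1/2 : ℝ) *
          (jb ℓ) ^ (-2 : ℝ) * (jbp (k - ℓ) (T • k - τ • ℓ)) ^ (-β)))
        ≤ ENNReal.ofReal C := by
  set M := ∫⁻ x : E3, ENNReal.ofReal (jb x ^ (-(β - 1)))
  have hMt : M < ∞ := lintegral_jb_rpow_lt_top (by linarith)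
  set N := ∫⁻ τ : ℝ, ENNReal.ofReal (8 * (1 + τ ^ 2)⁻¹)
  have hNt : N < ∞ := (integrable_inv_one_add_sq.const_mul 8).lintegral_lt_top
  refine ⟨(N * M).toReal + 1, by positivity, fun T _ k => ?_⟩
  calc _ ≤ ∫⁻ τ in Set.Icc (0:ℝ) T, ENNReal.ofReal (8 * (1 + τ ^ 2)⁻¹) * M :=
        setLIntegral_mono' measurableSet_Icc fun τ hτ => echo_inner_le (by linarith) T k hτ.1
    _ ≤ ∫⁻ τ, ENNReal.ofReal (8 * (1 + τ ^ 2)⁻¹) * M := setLIntegral_le_lintegral _ _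
    _ = N * M := lintegral_mul_const _ (by fun_prop)
    _ = ENNReal.ofReal (N * M).toReal := (ENNReal.ofReal_toReal (ENNReal.mul_lt_top hNt hMt).ne).symm
    _ ≤ _ := ENNReal.ofReal_le_ofReal (by linarith)
end
end

section
/- (Time response estimate II: column sums of the plasma echo kernel.) Let β > 10. There is a constant C(β) such that for all τ ≥ 0 and all ℓ ∈ ℝ³: ∫_{ℝ³} ∫_τ^∞ ⟨t⟩ |k|^{1/2} |ℓ|^{1/2} ⟨ℓ⟩^{−2} ⟨k−ℓ, kt−ℓτ⟩^{−β} dt dk ≤ C(β). -/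
open MeasureTheory Real Complex
open scoped ENNReal

noncomputable section

lemma one_le_jbp (a b : E3) : 1 ≤ jbp a b :=
  (one_le_jb a).trans (jb_le_jbp_left a b)

lemma jbR_le_one_add {t : ℝ} (ht : 0 ≤ t) : jbR t ≤ 1 + t :=
  Real.sqrt_le_iff.2 ⟨by linarith, by nlinarith⟩

lemma continuous_jb : Continuous jb := by
  unfold jb
  fun_prop

/-- The frequency weights are absorbed by half a power of the kernel. -/
lemma weight_mul_jbp_rpow_le (β : ℝ) (k ℓ b : E3) :
    ‖k‖ ^ (1/2 : ℝ) * ‖ℓ‖ ^ (1/2 : ℝ) * (jb ℓ) ^ (-2 : ℝ) * (jbp (k - ℓ) b) ^ (-β) ≤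
      2 * (jbp (k - ℓ) b) ^ (-(β - 1/2)) := by
  have hL := one_le_jb ℓ
  have hP := one_le_jbp (k - ℓ) b
  have hm : ‖k - ℓ‖ ≤ jbp (k - ℓ) b := (norm_le_jb _).trans (jb_le_jbp_left _ _)
  have hl := norm_le_jb ℓ
  set L := jb ℓ
  set P := jbp (k - ℓ) b
  have hL0 : 0 < L := by linarith
  have hP0 : 0 < P := by linarith
  have hk : ‖k‖ ≤ 4 * (L * P) := by
    have : ‖k‖ ≤ ‖k - ℓ‖ + ‖ℓ‖ := by simpa using norm_add_le (k - ℓ) ℓ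
    nlinarith
  have h4 : (4 : ℝ) ^ (1/2 : ℝ) = 2 := by
    rw [← Real.sqrt_eq_rpow, show (4 : ℝ) = 2 ^ 2 by norm_num]
    exact Real.sqrt_sq (by norm_num)
  have hk' : ‖k‖ ^ (1/2 : ℝ) ≤ 2 * (L ^ (1/2 : ℝ) * P ^ (1/2 : ℝ)) := by
    have := Real.rpow_le_rpow (norm_nonneg _) hk (by norm_num : (0 : ℝ) ≤ 1/2)
    rwa [Real.mul_rpow (by norm_num) (by positivity), Real.mul_rpow hL0.le hP0.le, h4] at this
  have hl' : ‖ℓ‖ ^ (1/2 : ℝ) ≤ L ^ (1/2 : ℝ) :=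
    Real.rpow_le_rpow (norm_nonneg _) hl (by norm_num)
  have hL1 : L ^ (1/2 : ℝ) * L ^ (1/2 : ℝ) * L ^ (-2 : ℝ) ≤ 1 := by
    rw [← Real.rpow_add hL0, ← Real.rpow_add hL0]
    exact Real.rpow_le_one_of_one_le_of_nonpos hL (by norm_num)
  have hPe : P ^ (-(β - 1/2)) = P ^ (1/2 : ℝ) * P ^ (-β) := by
    rw [← Real.rpow_add hP0]; congr 1; ring
  calc _ ≤ 2 * (L ^ (1/2 : ℝ) * P ^ (1/2 : ℝ)) * L ^ (1/2 : ℝ) * L ^ (-2 : ℝ) * P ^ (-β) := by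
        gcongr
    _ = (L ^ (1/2 : ℝ) * L ^ (1/2 : ℝ) * L ^ (-2 : ℝ)) * (2 * (P ^ (1/2 : ℝ) * P ^ (-β))) := by
        ring
    _ ≤ 1 * (2 * (P ^ (1/2 : ℝ) * P ^ (-β))) := by gcongr
    _ = _ := by rw [hPe, one_mul]

lemma lintegral_comp_smul_sub {f : E3 → ℝ≥0∞} (hf : Measurable f) {t : ℝ} (ht : 0 < t) (a : E3) :
    ∫⁻ k : E3, f (t • k - a) = ENNReal.ofReal (t ^ (-3 : ℝ)) * ∫⁻ x, f x := by
  have h := lintegral_map (μ := (volume : Measure E3)) (f := fun x => f (x - a))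
    (g := fun k => t • k) (by fun_prop) (by fun_prop)
  rw [← h, Measure.map_addHaar_smul volume ht.ne', lintegral_smul_measure,
    lintegral_sub_right_eq_self, smul_eq_mul]
  congr 2
  rw [abs_of_pos (by positivity), Real.rpow_neg ht.le]
  simp

/-- Time response estimate II: column sums of the plasma echo kernel. -/
theorem time_response_II (β : ℝ) (hβ : 10 < β) :
    ∃ C : ℝ, 0 < C ∧ ∀ τ : ℝ, 0 ≤ τ → ∀ ℓ : E3,
      (∫⁻ k : E3, ∫⁻ t in Set.Ici τ,
        ENNReal.ofReal (jbR t * ‖k‖ ^ (1/2 : ℝ) * ‖ℓ‖ ^ (1/2 : ℝ) *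
          (jb ℓ) ^ (-2 : ℝ) * (jbp (k - ℓ) (t • k - τ • ℓ)) ^ (-β)))
        ≤ ENNReal.ofReal C := by
  set w : E3 → ℝ≥0∞ := fun x => ENNReal.ofReal (jb x ^ (-(β - 1/2))) with hw
  have hwm : Measurable w := (continuous_jb.measurable.pow_const _).ennreal_ofReal
  set J := ∫⁻ x, w x
  have hJ : J < ∞ := lintegral_jb_rpow_lt_top (by linarith)
  set T := ∫⁻ t in Set.Ioi (1 : ℝ), ENNReal.ofReal (t ^ (-2 : ℝ))
  have hT : T < ∞ :=
    (integrableOn_Ioi_rpow_of_lt (by norm_num) one_pos).lintegral_lt_top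
  have hB : 4 * J + 4 * (T * J) < ∞ :=
    ENNReal.add_lt_top.2 ⟨ENNReal.mul_lt_top (by simp) hJ,
      ENNReal.mul_lt_top (by simp) (ENNReal.mul_lt_top hT hJ)⟩
  refine ⟨(4 * J + 4 * (T * J)).toReal + 1, by positivity, fun τ hτ ℓ => ?_⟩
  have hpt (t : ℝ) (ht : 0 ≤ t) (k x : E3) (hx : jb x ≤ jbp (k - ℓ) (t • k - τ • ℓ)) :
      ENNReal.ofReal (jbR t * ‖k‖ ^ (1/2 : ℝ) * ‖ℓ‖ ^ (1/2 : ℝ) *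
          (jb ℓ) ^ (-2 : ℝ) * (jbp (k - ℓ) (t • k - τ • ℓ)) ^ (-β)) ≤
        ENNReal.ofReal (2 * (1 + t)) * w x := by
    rw [hw, ← ENNReal.ofReal_mul (by positivity)]
    refine ENNReal.ofReal_le_ofReal ?_
    have h1 := weight_mul_jbp_rpow_le β k ℓ (t • k - τ • ℓ)
    have h2 : jbp (k - ℓ) (t • k - τ • ℓ) ^ (-(β - 1/2)) ≤ jb x ^ (-(β - 1/2)) :=
      Real.rpow_le_rpow_of_nonpos (by linarith [one_le_jb x]) hx (by linarith)
    calc _ = jbR t * (‖k‖ ^ (1/2 : ℝ) * ‖ℓ‖ ^ (1/2 : ℝ) *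
          (jb ℓ) ^ (-2 : ℝ) * (jbp (k - ℓ) (t • k - τ • ℓ)) ^ (-β)) := by ring
      _ ≤ jbR t * (2 * jb x ^ (-(β - 1/2))) :=
          mul_le_mul_of_nonneg_left (by linarith) (Real.sqrt_nonneg _)
      _ ≤ (1 + t) * (2 * jb x ^ (-(β - 1/2))) := by
          have := one_le_jb x
          exact mul_le_mul_of_nonneg_right (jbR_le_one_add ht) (by positivity)
      _ = _ := by ring
  have hsmall (k : E3) : ∫⁻ t in Set.Icc (0 : ℝ) 1,
      ENNReal.ofReal (jbR t * ‖k‖ ^ (1/2 : ℝ) * ‖ℓ‖ ^ (1/2 : ℝ) *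
          (jb ℓ) ^ (-2 : ℝ) * (jbp (k - ℓ) (t • k - τ • ℓ)) ^ (-β)) ≤ 4 * w (k - ℓ) := by
    calc _ ≤ ∫⁻ _ in Set.Icc (0 : ℝ) 1, 4 * w (k - ℓ) := by
          refine setLIntegral_mono' measurableSet_Icc fun t ht => ?_
          refine (hpt t ht.1 k _ (jb_le_jbp_left _ _)).trans ?_
          gcongr
          rw [show (4 : ℝ≥0∞) = ENNReal.ofReal 4 by simp]
          exact ENNReal.ofReal_le_ofReal (by linarith [ht.2])
      _ = _ := by simp
  have hlarge (k : E3) : ∫⁻ t in Set.Ioi (1 : ℝ),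
      ENNReal.ofReal (jbR t * ‖k‖ ^ (1/2 : ℝ) * ‖ℓ‖ ^ (1/2 : ℝ) *
          (jb ℓ) ^ (-2 : ℝ) * (jbp (k - ℓ) (t • k - τ • ℓ)) ^ (-β)) ≤
      ∫⁻ t in Set.Ioi (1 : ℝ), ENNReal.ofReal (4 * t) * w (t • k - τ • ℓ) := by
    refine setLIntegral_mono' measurableSet_Ioi fun t (ht : 1 < t) => ?_
    refine (hpt t (by linarith) k _ (jb_le_jbp_right _ _)).trans ?_
    exact mul_le_mul_left (ENNReal.ofReal_le_ofReal (by linarith)) _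
  have htail : ∫⁻ k : E3, ∫⁻ t in Set.Ioi (1 : ℝ),
      ENNReal.ofReal (4 * t) * w (t • k - τ • ℓ) = 4 * (T * J) := by
    rw [lintegral_lintegral_swap (by fun_prop)]
    calc _ = ∫⁻ t in Set.Ioi (1 : ℝ), 4 * (ENNReal.ofReal (t ^ (-2 : ℝ)) * J) := by
          refine setLIntegral_congr_fun measurableSet_Ioi fun t (ht : 1 < t) => ?_
          have ht0 : 0 < t := by linarith
          rw [lintegral_const_mul _ (by fun_prop), lintegral_comp_smul_sub hwm ht0, ← mul_assoc,
            ← mul_assoc, ← ENNReal.ofReal_mul (by positivity),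
            show (4 : ℝ≥0∞) = ENNReal.ofReal 4 by simp, ← ENNReal.ofReal_mul (by norm_num),
            mul_assoc 4 t]
          congr 3
          rw [← Real.rpow_one_add' ht0.le (by norm_num)]
          norm_num
      _ = _ := by
          rw [lintegral_const_mul _ (by fun_prop), lintegral_mul_const _ (by fun_prop)]
  have hcover : Set.Ici τ ⊆ Set.Icc (0 : ℝ) 1 ∪ Set.Ioi 1 := fun t (ht : τ ≤ t) =>
    (le_or_gt t 1).imp (fun h => ⟨hτ.trans ht, h⟩) id
  calc _ ≤ ∫⁻ k : E3, (4 * w (k - ℓ) +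
        ∫⁻ t in Set.Ioi (1 : ℝ), ENNReal.ofReal (4 * t) * w (t • k - τ • ℓ)) :=
        lintegral_mono fun k => (lintegral_mono_set hcover).trans <|
          (lintegral_union_le _ _ _).trans (add_le_add (hsmall k) (hlarge k))
    _ = 4 * J + 4 * (T * J) := by
        rw [lintegral_add_left (by fun_prop), htail, lintegral_const_mul _ (by fun_prop),
          lintegral_sub_right_eq_self w ℓ]
    _ = ENNReal.ofReal (4 * J + 4 * (T * J)).toReal := (ENNReal.ofReal_toReal hB.ne).symm
    _ ≤ _ := ENNReal.ofReal_le_ofReal (by linarith)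
end
end

section
/- (Symbol difference estimate in the reaction regime.) Let σ ≥ 1, 0 < δ < 1 and t ≥ 0. There is a constant C(σ,δ) such that for all k, ℓ, η ∈ ℝ³ satisfying |(ℓ, ℓt)| ≥ |(k−ℓ, η−tℓ)|: | |k|^δ ⟨k,η⟩^σ − |k−ℓ|^δ ⟨k−ℓ, η−tℓ⟩^σ | ≤ C(σ,δ) ( |ℓ|^δ + |k−ℓ|^δ ) ⟨ℓ, ℓt⟩^σ. -/
open MeasureTheory Real Complex
open scoped ENNReal

noncomputable section

/-- the Euclidean norm |(a,b)| of a pair of vectors -/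
def pn (a b : E3) : ℝ := Real.sqrt (‖a‖^2 + ‖b‖^2)

lemma norm_sq_le_two_mul_add_sq_sub {E : Type*} [SeminormedAddCommGroup E] (a b : E) :
    ‖a‖ ^ 2 ≤ 2 * (‖a - b‖ ^ 2 + ‖b‖ ^ 2) := by
  have h : ‖a‖ ≤ ‖a - b‖ + ‖b‖ := by simpa using norm_add_le (a - b) b
  calc ‖a‖ ^ 2 ≤ (‖a - b‖ + ‖b‖) ^ 2 := by gcongr
    _ ≤ 2 * (‖a - b‖ ^ 2 + ‖b‖ ^ 2) := add_sq_le

lemma jbp_nonneg (a b : E3) : 0 ≤ jbp a b := Real.sqrt_nonneg _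

lemma jbp_le_jbp_of_pn_le {a b c d : E3} (h : pn a b ≤ pn c d) : jbp a b ≤ jbp c d := by
  have h' := (Real.sqrt_le_sqrt_iff (by positivity)).1 h
  exact Real.sqrt_le_sqrt (by linarith)

lemma jbp_le_two_mul_jbp_of_pn_sub_le {a b c d : E3} (h : pn (a - c) (b - d) ≤ pn c d) :
    jbp a b ≤ 2 * jbp c d := by
  have h' := (Real.sqrt_le_sqrt_iff (by positivity)).1 h
  have ha := norm_sq_le_two_mul_add_sq_sub a c
  have hb := norm_sq_le_two_mul_add_sq_sub b d
  refine Real.sqrt_le_iff.2 ⟨mul_nonneg zero_le_two (jbp_nonneg c d), ?_⟩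
  rw [jbp, mul_pow, Real.sq_sqrt (by positivity)]
  linarith

lemma norm_rpow_le_norm_rpow_add_norm_sub_rpow {E : Type*} [SeminormedAddCommGroup E] {δ : ℝ}
    (hδ0 : 0 ≤ δ) (hδ1 : δ ≤ 1) (a b : E) : ‖a‖ ^ δ ≤ ‖b‖ ^ δ + ‖a - b‖ ^ δ := by
  have h : ‖a‖ ≤ ‖b‖ + ‖a - b‖ := by simpa using norm_add_le b (a - b)
  exact (Real.rpow_le_rpow (norm_nonneg a) h hδ0).trans
    (Real.rpow_add_le_add_rpow (norm_nonneg _) (norm_nonneg _) hδ0 hδ1)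

/-- Symbol difference estimate in the reaction regime. -/
theorem symbol_difference_reaction (σ δ : ℝ) (hσ : 1 ≤ σ) (hδ0 : 0 < δ) (hδ1 : δ < 1) :
    ∃ C : ℝ, 0 < C ∧ ∀ t : ℝ, 0 ≤ t → ∀ k ℓ η : E3,
      pn (k - ℓ) (η - t • ℓ) ≤ pn ℓ (t • ℓ) →
      |‖k‖ ^ δ * (jbp k η) ^ σ - ‖k - ℓ‖ ^ δ * (jbp (k - ℓ) (η - t • ℓ)) ^ σ|
        ≤ C * (‖ℓ‖ ^ δ + ‖k - ℓ‖ ^ δ) * (jbp ℓ (t • ℓ)) ^ σ := by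
  refine ⟨2 ^ σ, by positivity, fun t _ k ℓ η h => ?_⟩
  have hσ0 : 0 ≤ σ := zero_le_one.trans hσ
  have hJ := jbp_nonneg ℓ (t • ℓ)
  have bound {x y : ℝ} (hx : x ≤ ‖ℓ‖ ^ δ + ‖k - ℓ‖ ^ δ) (hy0 : 0 ≤ y)
      (hy : y ≤ 2 * jbp ℓ (t • ℓ)) :
      x * y ^ σ ≤ 2 ^ σ * (‖ℓ‖ ^ δ + ‖k - ℓ‖ ^ δ) * jbp ℓ (t • ℓ) ^ σ := by
    calc x * y ^ σ ≤ (‖ℓ‖ ^ δ + ‖k - ℓ‖ ^ δ) * (2 * jbp ℓ (t • ℓ)) ^ σ := by gcongr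
      _ = _ := by rw [Real.mul_rpow zero_le_two hJ]; ring
  have hA := bound (norm_rpow_le_norm_rpow_add_norm_sub_rpow hδ0.le hδ1.le k ℓ)
    (jbp_nonneg k η) (jbp_le_two_mul_jbp_of_pn_sub_le h)
  have hB := bound (le_add_of_nonneg_left (Real.rpow_nonneg (norm_nonneg ℓ) δ))
    (jbp_nonneg (k - ℓ) (η - t • ℓ))
    ((jbp_le_jbp_of_pn_le h).trans (le_mul_of_one_le_left hJ one_le_two))
  have hA0 : 0 ≤ ‖k‖ ^ δ * jbp k η ^ σ :=
    mul_nonneg (by positivity) (Real.rpow_nonneg (jbp_nonneg _ _) _)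
  have hB0 : 0 ≤ ‖k - ℓ‖ ^ δ * jbp (k - ℓ) (η - t • ℓ) ^ σ :=
    mul_nonneg (by positivity) (Real.rpow_nonneg (jbp_nonneg _ _) _)
  exact abs_sub_le_of_nonneg_of_le hA0 hA hB0 hB
end
end
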